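/- For every natural number k ≥ 1, h(k) = ((2 + √2)^(k+1) − (2 − √2)^(k+1)) / (4·√2), where the right-hand side is a real number and h(k) is cast from ℕ to ℝ. -/

import Mathlib

/-- `hcomp k` is the sum over all compositions `c` of `k` of `∏_{p ∈ c.blocks} (p + 1)`;
in particular `hcomp 0 = 1`. -/
def hcomp (k : ℕ) : ℕ := ∑ c : Composition k, (c.blocks.map (· + 1)).prod

/-- Prepend a first block of size `n + 1 - j` to a composition of `j ≤ n`. -/
def consComp (n : ℕ) (x : Σ j : Fin (n + 1), Composition (j : ℕ)) : Composition (n + 1) where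
  blocks := (n + 1 - (x.1 : ℕ)) :: x.2.blocks
  blocks_pos := by
    intro i hi
    have := x.1.2
    rcases List.mem_cons.1 hi with h | h
    · omega
    · exact x.2.blocks_pos h
  blocks_sum := by
    have := x.1.2
    rw [List.sum_cons, x.2.blocks_sum]
    omega

lemma consComp_bij (n : ℕ) : Function.Bijective (consComp n) := by
  constructor
  · rintro ⟨i, c⟩ ⟨j, d⟩ h
    have h' := congrArg Composition.blocks h
    simp only [consComp, List.cons.injEq] at h'
    obtain ⟨h1, h2⟩ := h'
    have hij : i = j := by
      apply Fin.ext
      have := i.2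
      have := j.2
      omega
    subst hij
    have : c = d := Composition.ext h2
    rw [this]
  · intro c
    rcases hb : c.blocks with _ | ⟨p, l⟩
    · have := c.blocks_sum
      rw [hb] at this
      simp at this
    · have hs := c.blocks_sum
      rw [hb, List.sum_cons] at hs
      have hp : 0 < p := c.blocks_pos (by rw [hb]; simp)
      refine ⟨⟨⟨l.sum, by omega⟩, ⟨l, ?_, rfl⟩⟩, ?_⟩
      · intro i hi
        exact c.blocks_pos (by rw [hb]; simp [hi])
      · apply Composition.ext
        simp only [consComp, hb, List.cons.injEq, and_true]
        omega

lemma hcomp_succ (n : ℕ) :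
    hcomp (n + 1) = ∑ j ∈ Finset.range (n + 1), (n + 2 - j) * hcomp j := by
  rw [Finset.sum_range (fun j => (n + 2 - j) * hcomp j)]
  unfold hcomp
  rw [← (consComp_bij n).sum_comp, Fintype.sum_sigma]
  refine Finset.sum_congr rfl fun j _ => ?_
  rw [Finset.mul_sum]
  refine Finset.sum_congr rfl fun c _ => ?_
  simp only [consComp, List.map_cons, List.prod_cons]
  have := j.2
  congr 1
  omega

lemma hcomp_step (n : ℕ) :
    hcomp (n + 2) = 3 * hcomp (n + 1) + ∑ j ∈ Finset.range (n + 1), hcomp j := by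
  rw [hcomp_succ (n + 1), Finset.sum_range_succ]
  have : ∑ j ∈ Finset.range (n + 1), (n + 1 + 2 - j) * hcomp j
      = hcomp (n + 1) + ∑ j ∈ Finset.range (n + 1), hcomp j := by
    rw [hcomp_succ n, ← Finset.sum_add_distrib]
    refine Finset.sum_congr rfl fun j hj => ?_
    have := Finset.mem_range.1 hj
    rw [show n + 1 + 2 - j = (n + 2 - j) + 1 by omega]
    ring
  rw [this, show n + 1 + 2 - (n + 1) = 2 by omega]
  ring

lemma hcomp_rec (n : ℕ) : hcomp (n + 3) + 2 * hcomp (n + 1) = 4 * hcomp (n + 2) := by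
  have h1 := hcomp_step n
  have h2 := hcomp_step (n + 1)
  rw [Finset.sum_range_succ] at h2
  have e : n + 1 + 2 = n + 3 := rfl
  have e' : n + 1 + 1 = n + 2 := rfl
  rw [e, e'] at h2
  omega

lemma hcomp_zero : hcomp 0 = 1 := by decide

lemma hcomp_one : hcomp 1 = 2 := by
  rw [hcomp_succ 0]; simp [hcomp_zero]

lemma hcomp_two : hcomp 2 = 7 := by
  rw [hcomp_step 0]; simp [hcomp_zero, hcomp_one]

lemma hcomp_closed (n : ℕ) :
    (hcomp (n + 1) : ℝ) * (4 * Real.sqrt 2) =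
      (2 + Real.sqrt 2) ^ (n + 2) - (2 - Real.sqrt 2) ^ (n + 2) := by
  have hs : Real.sqrt 2 ^ 2 = 2 := Real.sq_sqrt (by norm_num)
  induction n using Nat.twoStepInduction with
  | zero => simp only [Nat.zero_add, hcomp_one]; push_cast; ring
  | one =>
    simp only [Nat.reduceAdd, hcomp_two]; push_cast
    linear_combination (-2 * Real.sqrt 2) * hs
  | more n h1 h2 =>
    have h := hcomp_rec n
    have h' : (hcomp (n + 3) : ℝ) + 2 * hcomp (n + 1) = 4 * hcomp (n + 2) := by exact_mod_cast h
    have e : n + 1 + 1 = n + 2 := rfl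
    rw [e] at h2
    have e3 : n + 2 + 1 = n + 3 := rfl
    rw [e3]
    linear_combination (4 * Real.sqrt 2) * h' + 4 * h2 - 2 * h1
      - ((2 + Real.sqrt 2) ^ (n + 2) - (2 - Real.sqrt 2) ^ (n + 2)) * hs

/-- Closed form: for `k ≥ 1`,
`hcomp k = ((2 + √2)^(k+1) − (2 − √2)^(k+1)) / (4√2)`. -/
theorem stmt_12 (k : ℕ) (hk : 1 ≤ k) :
    (hcomp k : ℝ) =
      ((2 + Real.sqrt 2) ^ (k + 1) - (2 - Real.sqrt 2) ^ (k + 1)) / (4 * Real.sqrt 2) := by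
  obtain ⟨n, rfl⟩ : ∃ n, k = n + 1 := ⟨k - 1, by omega⟩
  rw [eq_div_iff (by positivity)]
  exact hcomp_closed n
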